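/- Lemma 2: for the (2^{nR1}, ..., 2^{nRK}, n; p) random code ensemble used over the (K, L)-DM-IN, if D1 ⊆ S ⊆ [K], then lim_{n→∞} (1/n) H(Y1^n | X_S^n, C_n) = H(Y1 | X_{[K]}, Q) + min over U ⊆ S^c of ( R_U + I(X_{(S∪U)^c}; Y1 | X_{S∪U}, Q) ), where C_n denotes the entire random codebook (Q^n and all codewords), X_S^n = (Xk^n(Mk) : k ∈ S) are the transmitted codewords of the senders in S, Y1^n is the output at receiver 1, and R_U = Σ_{k∈U} Rk. -/

import Mathlib

open scoped BigOperators
open Filter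

set_option synthInstance.maxSize 4000
set_option synthInstance.maxHeartbeats 1000000
set_option maxHeartbeats 1000000

noncomputable section

/-- Shannon entropy (base 2) of a finitely supported distribution `p`. -/
def ent {α : Type*} [Fintype α] (p : α → ℝ) : ℝ := -∑ a, p a * Real.logb 2 (p a)

/-- The distribution (pushforward) of a random variable `f` on the finite
probability space `(Ω, p)`. -/
def distOf {Ω β : Type*} [Fintype Ω] [DecidableEq β] (p : Ω → ℝ) (f : Ω → β) : β → ℝ :=
  fun b => ∑ ω, if f ω = b then p ω else 0

/-- The entropy `H(f)` of a random variable `f` on the finite probability space `(Ω, p)`. -/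
def entOf {Ω β : Type*} [Fintype Ω] [Fintype β] [DecidableEq β] (p : Ω → ℝ) (f : Ω → β) : ℝ :=
  ent (distOf p f)

/-- The conditional entropy `H(f | g)`. -/
def condEnt {Ω β γ : Type*} [Fintype Ω] [Fintype β] [Fintype γ] [DecidableEq β] [DecidableEq γ]
    (p : Ω → ℝ) (f : Ω → β) (g : Ω → γ) : ℝ :=
  entOf p (fun ω => (f ω, g ω)) - entOf p g

/-- The mutual information `I(f; g)`. -/
def mutInfo {Ω β γ : Type*} [Fintype Ω] [Fintype β] [Fintype γ] [DecidableEq β] [DecidableEq γ]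
    (p : Ω → ℝ) (f : Ω → β) (g : Ω → γ) : ℝ :=
  entOf p f + entOf p g - entOf p (fun ω => (f ω, g ω))

/-- The conditional mutual information `I(f; g | h)`. -/
def condMutInfo {Ω β γ δ : Type*} [Fintype Ω] [Fintype β] [Fintype γ] [Fintype δ]
    [DecidableEq β] [DecidableEq γ] [DecidableEq δ]
    (p : Ω → ℝ) (f : Ω → β) (g : Ω → γ) (h : Ω → δ) : ℝ :=
  entOf p (fun ω => (f ω, h ω)) + entOf p (fun ω => (g ω, h ω)) -
    entOf p (fun ω => (f ω, g ω, h ω)) - entOf p h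

/-- `p` is a probability mass function on the finite alphabet `α`. -/
def IsPMF {α : Type*} [Fintype α] (p : α → ℝ) : Prop := (∀ a, 0 ≤ p a) ∧ ∑ a, p a = 1

/-- The number `2^{nR}` of messages at blocklength `n` and rate `R` (in bits). -/
def msgSize (n : ℕ) (R : ℝ) : ℕ := max 1 ⌊(2 : ℝ) ^ ((n : ℝ) * R)⌋₊

instance (n : ℕ) (R : ℝ) : NeZero (msgSize n R) :=
  ⟨by have h : 1 ≤ msgSize n R := le_max_left _ _; omega⟩

/-- The `ε`-typical set: `xs` is `ε`-typical for the pmf `p` if the empirical frequency of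
every symbol `a` is within `ε · p a` of `p a`. -/
def Typical {α : Type*} [Fintype α] [DecidableEq α] (p : α → ℝ) (ε : ℝ) {n : ℕ}
    (xs : Fin n → α) : Prop :=
  ∀ a, |((Finset.univ.filter fun i => xs i = a).card : ℝ) / (n : ℝ) - p a| ≤ ε * p a

section FiniteExpectation

variable {Ω β γ : Type*} [Fintype Ω] [Fintype β] [Fintype γ] [DecidableEq β] [DecidableEq γ]

lemma sum_distOf_mul (p : Ω → ℝ) (f : Ω → β) (F : β → ℝ) :
    ∑ b, distOf p f b * F b = ∑ ω, p ω * F (f ω) := by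
  simp only [distOf, Finset.sum_mul]
  rw [Finset.sum_comm]
  refine Finset.sum_congr rfl fun ω _ => ?_
  simp [ite_mul]

lemma sum_mul_sum_mul_comm {Ω β : Type*} [Fintype Ω] [Fintype β] (p : Ω → ℝ)
    (r : β → ℝ) (F : Ω → β → ℝ) :
    ∑ ω, p ω * ∑ b, r b * F ω b = ∑ b, r b * ∑ ω, p ω * F ω b := by
  simp only [Finset.mul_sum]
  rw [Finset.sum_comm]
  exact Finset.sum_congr rfl fun _ _ => Finset.sum_congr rfl fun _ _ => mul_left_comm _ _ _

lemma entOf_eq_neg_sum (p : Ω → ℝ) (f : Ω → β) :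
    entOf p f = -∑ ω, p ω * Real.logb 2 (distOf p f (f ω)) := by
  rw [entOf, ent, sum_distOf_mul p f fun b => Real.logb 2 (distOf p f b)]

lemma entOf_congr (p : Ω → ℝ) {f : Ω → β} {g : Ω → γ}
    (h : ∀ ω ω', f ω = f ω' ↔ g ω = g ω') : entOf p f = entOf p g := by
  simp only [entOf_eq_neg_sum, distOf, h]

lemma distOf_nonneg {Ω β : Type*} [Fintype Ω] [DecidableEq β]
    {p : Ω → ℝ} (hp : ∀ ω, 0 ≤ p ω) (f : Ω → β) (b : β) :
    0 ≤ distOf p f b :=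
  Finset.sum_nonneg fun ω _ => by split_ifs <;> simp [hp ω]

lemma le_distOf {Ω β : Type*} [Fintype Ω] [DecidableEq β]
    {p : Ω → ℝ} (hp : ∀ ω, 0 ≤ p ω) (f : Ω → β) (ω : Ω) :
    p ω ≤ distOf p f (f ω) := by
  refine le_trans (by simp) (Finset.single_le_sum (f := fun ω' => if f ω' = f ω then p ω' else 0)
    (fun ω' _ => ?_) (Finset.mem_univ ω))
  split_ifs <;> simp [hp ω']

lemma sum_distOf (p : Ω → ℝ) (f : Ω → β) : ∑ b, distOf p f b = ∑ ω, p ω := by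
  simpa using sum_distOf_mul p f fun _ => 1

/-- If the conditional probability of `f` given `g` is `v`, then `H(f | g) = E[-log v]`. -/
lemma condEnt_eq_of_distOf_eq_mul {p : Ω → ℝ} (hp : ∀ ω, 0 ≤ p ω) (f : Ω → β) (g : Ω → γ)
    (v : Ω → ℝ)
    (hv : ∀ ω, distOf p (fun ω => (f ω, g ω)) (f ω, g ω) = distOf p g (g ω) * v ω) :
    condEnt p f g = ∑ ω, p ω * -Real.logb 2 (v ω) := by
  rw [condEnt, entOf_eq_neg_sum, entOf_eq_neg_sum, neg_sub_neg, ← Finset.sum_sub_distrib]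
  refine Finset.sum_congr rfl fun ω _ => ?_
  rcases (hp ω).eq_or_lt with h0 | h0
  · simp [← h0]
  have h1 : 0 < distOf p g (g ω) := h0.trans_le (le_distOf hp g ω)
  have h2 : 0 < distOf p (fun ω => (f ω, g ω)) (f ω, g ω) :=
    h0.trans_le (le_distOf hp (fun ω => (f ω, g ω)) ω)
  rw [hv ω] at h2 ⊢
  rw [Real.logb_mul h1.ne' (pos_of_mul_pos_right h2 h1.le).ne']
  ring

lemma pos_of_distOf_eq_mul {Ω β γ : Type*} [Fintype Ω] [DecidableEq β] [DecidableEq γ]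
    {p : Ω → ℝ} (hp : ∀ ω, 0 ≤ p ω) (f : Ω → β) (g : Ω → γ)
    (v : Ω → ℝ)
    (hv : ∀ ω, distOf p (fun ω => (f ω, g ω)) (f ω, g ω) = distOf p g (g ω) * v ω)
    {ω : Ω} (h0 : 0 < p ω) : 0 < v ω := by
  have h1 : 0 < distOf p g (g ω) := h0.trans_le (le_distOf hp g ω)
  have h2 : 0 < distOf p (fun ω => (f ω, g ω)) (f ω, g ω) :=
    h0.trans_le (le_distOf hp (fun ω => (f ω, g ω)) ω)
  rw [hv ω] at h2
  exact pos_of_mul_pos_right h2 h1.le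

/-- Jensen's inequality for the logarithm, in the form `E[-log b] ≤ E[-log a]` whenever
`E[a / b] ≤ 1`. -/
lemma sum_mul_neg_logb_le {p : Ω → ℝ} (hp : IsPMF p) (a b : Ω → ℝ)
    (ha : ∀ ω, 0 < p ω → 0 < a ω) (hb : ∀ ω, 0 < p ω → 0 < b ω)
    (h : ∑ ω, p ω * (a ω / b ω) ≤ 1) :
    ∑ ω, p ω * -Real.logb 2 (b ω) ≤ ∑ ω, p ω * -Real.logb 2 (a ω) := by
  have key : ∀ ω, p ω * -Real.logb 2 (b ω) ≤
      p ω * -Real.logb 2 (a ω) + (p ω * (a ω / b ω) - p ω) / Real.log 2 := by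
    intro ω
    rcases (hp.1 ω).eq_or_lt with h0 | h0
    · simp [← h0]
    have h1 := ha ω h0
    have h2 := hb ω h0
    have hl := Real.log_le_sub_one_of_pos (div_pos h1 h2)
    rw [Real.log_div h1.ne' h2.ne'] at hl
    have h3 : (Real.log (a ω) - Real.log (b ω)) / Real.log 2 ≤ (a ω / b ω - 1) / Real.log 2 :=
      div_le_div_of_nonneg_right hl (Real.log_nonneg (by norm_num))
    have h4 := mul_le_mul_of_nonneg_left h3 h0.le
    simp only [Real.logb]
    have e1 : p ω * ((Real.log (a ω) - Real.log (b ω)) / Real.log 2) =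
      p ω * -(Real.log (b ω) / Real.log 2) - p ω * -(Real.log (a ω) / Real.log 2) := by ring
    have e2 : p ω * ((a ω / b ω - 1) / Real.log 2) =
      (p ω * (a ω / b ω) - p ω) / Real.log 2 := by ring
    linarith
  refine (Finset.sum_le_sum fun ω _ => key ω).trans ?_
  rw [Finset.sum_add_distrib, ← Finset.sum_div, Finset.sum_sub_distrib, hp.2]
  have : (∑ ω, p ω * (a ω / b ω) - 1) / Real.log 2 ≤ 0 :=
    div_nonpos_of_nonpos_of_nonneg (by linarith) (Real.log_nonneg (by norm_num))
  linarith

end FiniteExpectation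

section ProductLaws

variable {ι : Type*} [Fintype ι] [DecidableEq ι] {α β : ι → Type*} [∀ i, Fintype (α i)]
  [∀ i, DecidableEq (β i)]

lemma sum_pi_prod (f : ∀ i, α i → ℝ) : ∑ x : ∀ i, α i, ∏ i, f i (x i) = ∏ i, ∑ a, f i a := by
  rw [Finset.prod_univ_sum, Fintype.piFinset_univ]

lemma isPMF_pi {μ : ∀ i, α i → ℝ} (hμ : ∀ i, IsPMF (μ i)) :
    IsPMF fun x : ∀ i, α i => ∏ i, μ i (x i) :=
  ⟨fun x => Finset.prod_nonneg fun i _ => (hμ i).1 _, by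
    rw [sum_pi_prod]; exact Finset.prod_eq_one fun i _ => (hμ i).2⟩

/-- Exchanging the coordinates outside `A` between two independent copies of a product law
preserves their joint law. -/
lemma sum_sum_pi_swap (μ : ∀ i, α i → ℝ) (A : Finset ι)
    (F : (∀ i, α i) → (∀ i, α i) → ℝ) :
    ∑ x, ∑ x', (∏ i, μ i (x i)) * (∏ i, μ i (x' i)) * F x x' =
      ∑ x, ∑ x', (∏ i, μ i (x i)) * (∏ i, μ i (x' i)) *
        F (A.piecewise x x') (A.piecewise x' x) := by
  rw [← Fintype.sum_prod_type', ← Fintype.sum_prod_type']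
  refine Finset.sum_nbij' (fun z => (A.piecewise z.1 z.2, A.piecewise z.2 z.1))
    (fun z => (A.piecewise z.1 z.2, A.piecewise z.2 z.1)) (by simp) (by simp) ?_ ?_ ?_
  · intro z _
    ext i <;> by_cases h : i ∈ A <;> simp [h]
  · intro z _
    ext i <;> by_cases h : i ∈ A <;> simp [h]
  · intro z _
    have e1 : A.piecewise (A.piecewise z.1 z.2) (A.piecewise z.2 z.1) = z.1 := by
      ext i; by_cases h : i ∈ A <;> simp [h]
    have e2 : A.piecewise (A.piecewise z.2 z.1) (A.piecewise z.1 z.2) = z.2 := by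
      ext i; by_cases h : i ∈ A <;> simp [h]
    simp only [e1, e2]
    congr 1
    rw [← Finset.prod_mul_distrib, ← Finset.prod_mul_distrib]
    refine Finset.prod_congr rfl fun i _ => ?_
    by_cases h : i ∈ A <;> simp [h, mul_comm]

/-- Resampling the coordinates outside `A` preserves a product law. -/
lemma sum_pi_resample {μ : ∀ i, α i → ℝ} (hμ : ∀ i, IsPMF (μ i)) (A : Finset ι)
    (F : (∀ i, α i) → ℝ) :
    ∑ x, (∏ i, μ i (x i)) * F x =
      ∑ x, (∏ i, μ i (x i)) * ∑ x', (∏ i, μ i (x' i)) * F (A.piecewise x x') := by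
  have h := sum_sum_pi_swap μ A fun x _ => F x
  simp only [Finset.mul_sum, ← mul_assoc]
  rw [← h]
  refine Finset.sum_congr rfl fun x _ => ?_
  rw [← Finset.sum_mul, ← Finset.mul_sum, (isPMF_pi hμ).2, mul_one]

/-- Conditioning a product law on its coordinates in `A`: the coordinates outside `A` keep
their law. -/
lemma sum_pi_ite_resample {μ : ∀ i, α i → ℝ} (hμ : ∀ i, IsPMF (μ i)) (A : Finset ι)
    (E : (∀ i, α i) → Prop) [DecidablePred E] (hE : ∀ x x', E (A.piecewise x x') ↔ E x)
    (F : (∀ i, α i) → ℝ) (y : ∀ i, α i)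
    (hF : ∀ x x', E x → F (A.piecewise x x') = F (A.piecewise y x')) :
    (∑ x, if E x then (∏ i, μ i (x i)) * F x else 0) =
      (∑ x, if E x then ∏ i, μ i (x i) else 0) *
        ∑ x', (∏ i, μ i (x' i)) * F (A.piecewise y x') := by
  have h := sum_pi_resample hμ A fun x => if E x then F x else 0
  simp only [mul_ite, mul_zero] at h
  rw [h, Finset.sum_mul]
  refine Finset.sum_congr rfl fun x _ => ?_
  simp only [hE]
  split_ifs with hx
  · simp only [hF x _ hx]
  · simp

lemma distOf_pi (ν : ∀ i, α i → ℝ) (φ : ∀ i, α i → β i) (x : ∀ i, β i) :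
    distOf (fun c : ∀ i, α i => ∏ i, ν i (c i)) (fun c i => φ i (c i)) x =
      ∏ i, distOf (ν i) (φ i) (x i) := by
  simp only [distOf]
  rw [← sum_pi_prod (fun i a => if φ i a = x i then ν i a else 0)]
  refine Finset.sum_congr rfl fun c _ => ?_
  rw [Finset.prod_ite_zero]
  simp [funext_iff]

lemma sum_pi_map [∀ i, Fintype (β i)] (ν : ∀ i, α i → ℝ) (φ : ∀ i, α i → β i) (F : (∀ i, β i) → ℝ) :
    ∑ c : ∀ i, α i, (∏ i, ν i (c i)) * F (fun i => φ i (c i)) =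
      ∑ x, (∏ i, distOf (ν i) (φ i) (x i)) * F x := by
  rw [← sum_distOf_mul (fun c : ∀ i, α i => ∏ i, ν i (c i)) (fun c i => φ i (c i))]
  simp only [distOf_pi]

lemma distOf_pi_single {A : Type*} [Fintype A] [DecidableEq A] {μ : A → ℝ} (hμ : IsPMF μ)
    (m : ι) (a : A) :
    distOf (fun c : ι → A => ∏ i, μ (c i)) (fun c => c m) a = μ a := by
  have h : ∀ c : ι → A, (if c m = a then ∏ i, μ (c i) else 0) =
      ∏ i, μ (c i) * (if i = m then if c i = a then 1 else 0 else 1) := by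
    intro c
    rw [Finset.prod_mul_distrib, Finset.prod_ite_eq' Finset.univ m]
    simp
  simp only [distOf, h]
  rw [sum_pi_prod fun i x => μ x * (if i = m then if x = a then 1 else 0 else 1)]
  rw [Finset.prod_eq_single m]
  · simp
  · intro i _ hi; simp [hi, hμ.2]
  · simp

/-- The joint law of two coordinates of an i.i.d. sequence. -/
lemma distOf_pi_pair {A : Type*} [Fintype A] [DecidableEq A] {μ : A → ℝ} (hμ : IsPMF μ)
    (m m' : ι) :
    distOf (fun c : ι → A => ∏ i, μ (c i)) (fun c => (c m, c m')) =
      distOf (fun d : A × A => μ d.1 * μ d.2)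
        (fun d => (d.1, if m' = m then d.1 else d.2)) := by
  have hm := distOf_pi_single (ι := ι) hμ
  ext ⟨a, b⟩
  by_cases h : m' = m
  · subst h
    have := hm m' a
    simp only [distOf, Fintype.sum_prod_type, Prod.mk.injEq] at this ⊢
    simp only [if_true]
    by_cases hab : a = b
    · subst hab
      simp only [and_self, this]
      simp [← Finset.mul_sum, hμ.2, Finset.sum_ite_irrel]
    · have : ∀ x : A, ¬ (x = a ∧ x = b) := by rintro x ⟨rfl, rfl⟩; exact hab rfl
      simp [this]
  · have h1 : ∀ c : ι → A, (if (c m, c m') = (a, b) then ∏ i, μ (c i) else 0) =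
        ∏ i, μ (c i) * ((if i = m then if c i = a then 1 else 0 else 1) *
          (if i = m' then if c i = b then 1 else 0 else 1)) := by
      intro c
      rw [Finset.prod_mul_distrib, Finset.prod_mul_distrib, Finset.prod_ite_eq' Finset.univ m,
        Finset.prod_ite_eq' Finset.univ m']
      by_cases h1 : c m = a <;> by_cases h2 : c m' = b <;> simp [h1, h2]
    simp only [distOf, h1]
    rw [sum_pi_prod fun i x => μ x * ((if i = m then if x = a then 1 else 0 else 1) *
          (if i = m' then if x = b then 1 else 0 else 1))]
    rw [Finset.prod_eq_mul m m' (Ne.symm h)]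
    · simp [h, Ne.symm h]
    · rintro i _ ⟨h3, h4⟩; simp [h3, h4, hμ.2]
    · simp
    · simp

/-- The joint law of the codewords of two message tuples in a random codebook. -/
lemma sum_codebook_pair {J A : ι → Type*} [∀ i, Fintype (J i)] [∀ i, DecidableEq (J i)]
    [∀ i, Fintype (A i)] [∀ i, DecidableEq (A i)] {μ : ∀ i, A i → ℝ} (hμ : ∀ i, IsPMF (μ i))
    (m m' : ∀ i, J i) (F : (∀ i, A i) → (∀ i, A i) → ℝ) :
    ∑ c : ∀ i, J i → A i, (∏ i, ∏ j, μ i (c i j)) *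
        F (fun i => c i (m i)) (fun i => c i (m' i)) =
      ∑ x, ∑ x', (∏ i, μ i (x i)) * (∏ i, μ i (x' i)) *
        F x ((Finset.univ.filter fun i => m' i = m i).piecewise x x') := by
  have h1 := sum_pi_map (fun i (c : J i → A i) => ∏ j, μ i (c j))
    (fun i c => (c (m i), c (m' i))) fun z => F (fun i => (z i).1) (fun i => (z i).2)
  have h2 := sum_pi_map (fun i (d : A i × A i) => μ i d.1 * μ i d.2)
    (fun i d => (d.1, if m' i = m i then d.1 else d.2))
    fun z => F (fun i => (z i).1) (fun i => (z i).2)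
  simp only [distOf_pi_pair (hμ _)] at h1
  rw [h1, ← h2, ← Fintype.sum_prod_type']
  refine Finset.sum_nbij' (fun d => (fun i => (d i).1, fun i => (d i).2))
    (fun z i => (z.1 i, z.2 i)) (by simp) (by simp) (fun _ _ => rfl) (fun _ _ => rfl) ?_
  intro d _
  rw [Finset.prod_mul_distrib]
  congr 2
  ext i
  by_cases h : m' i = m i <;> simp [h]

/-- Every message tuple has codewords with the law `∏ i, μ i`. -/
lemma sum_codebook_single {J A : ι → Type*} [∀ i, Fintype (J i)] [∀ i, DecidableEq (J i)]
    [∀ i, Fintype (A i)] [∀ i, DecidableEq (A i)] {μ : ∀ i, A i → ℝ} (hμ : ∀ i, IsPMF (μ i))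
    (m : ∀ i, J i) (F : (∀ i, A i) → ℝ) :
    ∑ c : ∀ i, J i → A i, (∏ i, ∏ j, μ i (c i j)) * F (fun i => c i (m i)) =
      ∑ x, (∏ i, μ i (x i)) * F x := by
  rw [sum_codebook_pair hμ m m fun x _ => F x]
  refine Finset.sum_congr rfl fun x _ => ?_
  rw [← Finset.sum_mul, ← Finset.mul_sum, (isPMF_pi hμ).2, mul_one]

end ProductLaws

section LawOfLargeNumbers

variable {Z : Type*} [Fintype Z] [DecidableEq Z] {P : Z → ℝ}

lemma sum_iid_pair (hP : IsPMF P) {n : ℕ} (i j : Fin n) (G : Z → Z → ℝ) :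
    ∑ z : Fin n → Z, (∏ t, P (z t)) * G (z i) (z j) =
      ∑ a, ∑ b, P a * P b * G a (if j = i then a else b) := by
  have h := sum_distOf_mul (fun z : Fin n → Z => ∏ t, P (z t)) (fun z => (z i, z j))
    fun w => G w.1 w.2
  rw [← h, distOf_pi_pair hP, sum_distOf_mul, Fintype.sum_prod_type]

lemma sum_iid_sum (hP : IsPMF P) (g : Z → ℝ) (n : ℕ) :
    ∑ z : Fin n → Z, (∏ t, P (z t)) * ∑ i, g (z i) = n * ∑ a, P a * g a := by
  simp only [Finset.mul_sum]
  rw [Finset.sum_comm]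
  have : ∀ i : Fin n, ∑ z : Fin n → Z, (∏ t, P (z t)) * g (z i) = ∑ a, P a * g a := by
    intro i
    rw [sum_iid_pair hP i i fun a _ => g a]
    refine Finset.sum_congr rfl fun a _ => ?_
    rw [← Finset.sum_mul, ← Finset.mul_sum, hP.2, mul_one]
  simp [this, Finset.mul_sum]

lemma sum_iid_sq (hP : IsPMF P) (g : Z → ℝ) (hg : ∑ a, P a * g a = 0) (n : ℕ) :
    ∑ z : Fin n → Z, (∏ t, P (z t)) * (∑ i, g (z i)) ^ 2 = n * ∑ a, P a * g a ^ 2 := by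
  have key : ∀ i j : Fin n, ∑ z : Fin n → Z, (∏ t, P (z t)) * (g (z i) * g (z j)) =
      if j = i then ∑ a, P a * g a ^ 2 else 0 := by
    intro i j
    rw [sum_iid_pair hP i j fun a b => g a * g b]
    split_ifs with h
    · refine Finset.sum_congr rfl fun a _ => ?_
      rw [← Finset.sum_mul, ← Finset.mul_sum, hP.2, mul_one, sq]
    · have : ∀ a b, P a * P b * (g a * g b) = P a * g a * (P b * g b) := fun a b => by ring
      simp only [this, ← Finset.mul_sum, hg, mul_zero, Finset.sum_const_zero]
  have expand : ∀ z : Fin n → Z, (∏ t, P (z t)) * (∑ i, g (z i)) ^ 2 =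
      ∑ i, ∑ j, (∏ t, P (z t)) * (g (z i) * g (z j)) := by
    intro z
    rw [sq, Finset.sum_mul_sum, Finset.mul_sum]
    simp only [Finset.mul_sum]
  calc _ = ∑ i, ∑ j, ∑ z : Fin n → Z, (∏ t, P (z t)) * (g (z i) * g (z j)) := by
        simp only [expand]
        rw [Finset.sum_comm]
        exact Finset.sum_congr rfl fun i _ => Finset.sum_comm
    _ = _ := by simp [key]

/-- A quantitative `L¹` law of large numbers. -/
lemma sum_iid_abs_le (hP : IsPMF P) (g : Z → ℝ) (n : ℕ) :
    ∑ z : Fin n → Z, (∏ t, P (z t)) * |∑ i, g (z i) - n * ∑ a, P a * g a| ≤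
      √n * ((∑ a, P a * (g a - ∑ b, P b * g b) ^ 2 + 1) / 2) := by
  set h := ∑ a, P a * g a with hh
  have hcent : ∑ a, P a * (g a - h) = 0 := by
    simp [mul_sub, Finset.sum_sub_distrib, ← Finset.sum_mul, hP.2, hh]
  have hsq := sum_iid_sq hP (fun a => g a - h) hcent n
  have hsum : ∀ z : Fin n → Z, ∑ i, (g (z i) - h) = ∑ i, g (z i) - n * h := by
    intro z; simp [Finset.sum_sub_distrib]
  simp only [hsum] at hsq
  have hpi : IsPMF fun z : Fin n → Z => ∏ t, P (z t) := isPMF_pi fun _ => hP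
  rcases Nat.eq_zero_or_pos n with rfl | hn
  · simp
  have hs : 0 < √(n : ℝ) := Real.sqrt_pos.2 (by exact_mod_cast hn)
  have hss : √(n : ℝ) * √n = n := Real.mul_self_sqrt (by positivity)
  have hpt : ∀ s : ℝ, |s| ≤ s ^ 2 / (2 * √n) + √n / 2 := by
    intro s
    have : 0 ≤ (|s| - √n) ^ 2 := sq_nonneg _
    rw [← sub_nonneg]
    have e : s ^ 2 / (2 * √n) + √n / 2 - |s| = (|s| - √n) ^ 2 / (2 * √n) := by
      rw [← sq_abs s]; field_simp; ring
    rw [e]; positivity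
  calc _ ≤ ∑ z : Fin n → Z, (∏ t, P (z t)) *
        ((∑ i, g (z i) - n * h) ^ 2 / (2 * √n) + √n / 2) :=
        Finset.sum_le_sum fun z _ => mul_le_mul_of_nonneg_left (hpt _) (hpi.1 z)
    _ = (n * ∑ a, P a * (g a - h) ^ 2) / (2 * √n) + √n / 2 := by
        rw [← hsq, Finset.sum_div]
        simp only [mul_add, Finset.sum_add_distrib, ← Finset.sum_mul, hpi.2, mul_div_assoc, one_mul]
    _ = _ := by
        rw [show (n : ℝ) * ∑ a, P a * (g a - h) ^ 2 = √n * √n * ∑ a, P a * (g a - h) ^ 2 by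
          rw [hss]]
        field_simp

end LawOfLargeNumbers

section Rates

lemma logb_msgSize_le (n : ℕ) {R : ℝ} (hR : 0 ≤ R) : Real.logb 2 (msgSize n R) ≤ n * R := by
  have h1 : (1 : ℝ) ≤ 2 ^ ((n : ℝ) * R) := Real.one_le_rpow (by norm_num) (by positivity)
  have h2 : (msgSize n R : ℝ) ≤ 2 ^ ((n : ℝ) * R) := by
    rw [msgSize, Nat.cast_max]
    exact max_le (by simpa using h1) (Nat.floor_le (by positivity))
  have h3 : (0 : ℝ) < msgSize n R := by exact_mod_cast Nat.pos_of_ne_zero (NeZero.ne _)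
  rw [Real.logb_le_iff_le_rpow (by norm_num) h3]
  exact h2

lemma le_logb_msgSize (n : ℕ) (R : ℝ) : n * R - 1 ≤ Real.logb 2 (msgSize n R) := by
  have h3 : (0 : ℝ) < msgSize n R := by exact_mod_cast Nat.pos_of_ne_zero (NeZero.ne _)
  rw [Real.le_logb_iff_rpow_le (by norm_num) h3, Real.rpow_sub (by norm_num), Real.rpow_one]
  have h4 := Nat.lt_floor_add_one ((2 : ℝ) ^ ((n : ℝ) * R))
  have h5 : (⌊(2 : ℝ) ^ ((n : ℝ) * R)⌋₊ : ℝ) ≤ msgSize n R := by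
    exact_mod_cast le_max_right _ _
  have h6 : (1 : ℝ) ≤ msgSize n R := by exact_mod_cast le_max_left _ _
  rw [div_le_iff₀ (by norm_num)]
  linarith

lemma tendsto_logb_msgSize {R : ℝ} (hR : 0 ≤ R) :
    Tendsto (fun n : ℕ => (n : ℝ)⁻¹ * Real.logb 2 (msgSize n R)) atTop (nhds R) := by
  have h0 : Tendsto (fun n : ℕ => R - (n : ℝ)⁻¹) atTop (nhds R) := by
    simpa using (tendsto_inv_atTop_nhds_zero_nat (𝕜 := ℝ)).const_sub R
  refine tendsto_of_tendsto_of_tendsto_of_le_of_le' h0 tendsto_const_nhds ?_ ?_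
  · filter_upwards [eventually_gt_atTop 0] with n hn
    have hn' : (0 : ℝ) < n := by exact_mod_cast hn
    have := mul_le_mul_of_nonneg_left (le_logb_msgSize n R) (inv_nonneg.2 hn'.le)
    rwa [mul_sub, inv_mul_cancel_left₀ hn'.ne', mul_one] at this
  · filter_upwards [eventually_gt_atTop 0] with n hn
    have hn' : (0 : ℝ) < n := by exact_mod_cast hn
    have := mul_le_mul_of_nonneg_left (logb_msgSize_le n hR) (inv_nonneg.2 hn'.le)
    rwa [inv_mul_cancel_left₀ hn'.ne'] at this

end Rates

section Network

variable {K L : ℕ} {Q : Type*} {X : Fin K → Type*} {Y : Fin L → Type*}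
  [Fintype Q] [DecidableEq Q]
  [∀ k, Fintype (X k)] [∀ k, DecidableEq (X k)]
  [∀ l, Fintype (Y l)] [∀ l, DecidableEq (Y l)]

variable (pQ : Q → ℝ) (pX : ∀ k, Q → X k → ℝ) (W : (∀ k, X k) → (∀ l, Y l) → ℝ)

/-- The single-letter joint distribution of `(Q, X_{[K]}, Y_{[L]})` induced by the input pmf
`p(q) p(x1|q) ⋯ p(xK|q)` and the channel `p(y_{[L]} | x_{[K]})`. -/
def NjointP : Q × (∀ k, X k) × (∀ l, Y l) → ℝ := fun z =>
  pQ z.1 * (∏ k, pX k z.1 (z.2.1 k)) * W z.2.1 z.2.2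

/-- The rate region `𝓡_l(p)` for receiver `l` with demand set `Dl`: the union over all
`S ⊇ Dl` of the MAC regions `𝓡_{MAC(S, l)}(p)`. -/
def NRegion (Dl : Finset (Fin K)) (l : Fin L) : Set (Fin K → ℝ) :=
  {R | (∀ k, 0 ≤ R k) ∧ ∃ S : Finset (Fin K), Dl ⊆ S ∧
    ∀ T ⊆ S, ∑ k ∈ T, R k ≤
      condMutInfo (NjointP pQ pX W)
        (fun z => fun k : {k // k ∈ T} => z.2.1 k.1)
        (fun z => z.2.2 l)
        (fun z => ((fun k : {k // k ∈ S \ T} => z.2.1 k.1), z.1))}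

/-- A codebook for the `(K, L)` interference network. -/
abbrev NCodebook (Q : Type*) {K : ℕ} (X : Fin K → Type*) (n : ℕ) (M : Fin K → ℕ) : Type _ :=
  (Fin n → Q) × ∀ k, Fin (M k) → Fin n → X k

/-- The probability of a codebook under the `p`-distributed random code ensemble. -/
def NensembleP {n : ℕ} {M : Fin K → ℕ} (c : NCodebook Q X n M) : ℝ :=
  (∏ i, pQ (c.1 i)) * ∏ k, ∏ m, ∏ i, pX k (c.1 i) (c.2 k m i)

/-- The average probability of error of the code given by codebook `c` and decoders `d`
(receiver `l` errs if it misdecodes some message demanded by `D l`). -/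
def NPeCode (D : Fin L → Finset (Fin K)) {n : ℕ} {M : Fin K → ℕ}
    (c : NCodebook Q X n M) (d : ∀ l, (Fin n → Y l) → ∀ k, Fin (M k)) : ℝ :=
  (∏ k, (M k : ℝ))⁻¹ * ∑ m : ∀ k, Fin (M k), ∑ y : ∀ l, Fin n → Y l,
    (∏ i, W (fun k => c.2 k (m k) i) (fun l => y l i)) *
      (if ∀ l, ∀ k ∈ D l, d l (y l) k = m k then 0 else 1)

/-- The probability of error of the codebook `c` under optimal (maximum likelihood)
decoding. -/
def NPeOpt (D : Fin L → Finset (Fin K)) {n : ℕ} {M : Fin K → ℕ}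
    (c : NCodebook Q X n M) : ℝ :=
  ⨅ d : ∀ l, (Fin n → Y l) → ∀ k, Fin (M k), NPeCode W D c d

/-- The probability of error under optimal decoding at blocklength `n` and rate tuple `R`,
averaged over the random code ensemble. -/
def NavgPeOpt (D : Fin L → Finset (Fin K)) (R : Fin K → ℝ) (n : ℕ) : ℝ :=
  ∑ c : NCodebook Q X n (fun k => msgSize n (R k)),
    NensembleP pQ pX c * NPeOpt W D c

/-- The sample space of the full communication experiment for the network: a random
codebook, uniform messages, and the channel output sequences. -/
abbrev NExpSpace (Q : Type*) {K L : ℕ} (X : Fin K → Type*) (Y : Fin L → Type*)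
    (n : ℕ) (M : Fin K → ℕ) : Type _ :=
  NCodebook Q X n M × (∀ k, Fin (M k)) × (∀ l, Fin n → Y l)

/-- The joint distribution of the communication experiment for the network. -/
def NexpP {n : ℕ} {M : Fin K → ℕ} : NExpSpace Q X Y n M → ℝ := fun ω =>
  NensembleP pQ pX ω.1 * (∏ k, (M k : ℝ))⁻¹ *
    ∏ i, W (fun k => ω.1.2 k (ω.2.1 k) i) (fun l => ω.2.2 l i)

/-- The law of the output at receiver `l` given all channel inputs. -/
def outputLaw (l : Fin L) (x : ∀ k, X k) : Y l → ℝ := distOf (W x) fun y => y l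

/-- The law of the output at receiver `l` given `Q = q` and the channel inputs in `A`. -/
def partialOutputLaw (l : Fin L) (A : Finset (Fin K)) (q : Q) (x : ∀ k, X k) (y : Y l) : ℝ :=
  ∑ xt : ∀ k, X k, (∏ k, pX k q (xt k)) * outputLaw W l (A.piecewise x xt) y

/-- The memoryless extension of `outputLaw`. -/
def blockOutputLaw {n : ℕ} (l : Fin L) (x : ∀ k, Fin n → X k) (y : Fin n → Y l) : ℝ :=
  ∏ i, outputLaw W l (fun k => x k i) (y i)

/-- The memoryless extension of `partialOutputLaw`. -/
def blockPartialOutputLaw {n : ℕ} (l : Fin L) (A : Finset (Fin K)) (q : Fin n → Q)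
    (x : ∀ k, Fin n → X k) (y : Fin n → Y l) : ℝ :=
  ∏ i, partialOutputLaw pX W l A (q i) (fun k => x k i) (y i)

/-- The law of the output at receiver `l` given the codebook and the messages in `S`. -/
def mixtureLaw {n : ℕ} {M : Fin K → ℕ} (l : Fin L) (S : Finset (Fin K))
    (c : ∀ k, Fin (M k) → Fin n → X k) (m : ∀ k, Fin (M k)) (y : Fin n → Y l) : ℝ :=
  ∑ m' : ∀ k, Fin (M k), (∏ k, (M k : ℝ)⁻¹) *
    blockOutputLaw W l (fun k => c k (S.piecewise m m' k)) y

section RandomCodebook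

set_option linter.unusedSectionVars false

variable {pQ pX W}

lemma isPMF_outputLaw (hW : ∀ x, IsPMF (W x)) (l : Fin L) (x : ∀ k, X k) :
    IsPMF (outputLaw W l x) :=
  ⟨distOf_nonneg (hW x).1 _, by simp only [outputLaw, sum_distOf, (hW x).2]⟩

lemma isPMF_partialOutputLaw (hpX : ∀ k q, IsPMF (pX k q)) (hW : ∀ x, IsPMF (W x)) (l : Fin L)
    (A : Finset (Fin K)) (q : Q) (x : ∀ k, X k) : IsPMF (partialOutputLaw pX W l A q x) := by
  have hpi := isPMF_pi fun k => hpX k q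
  refine ⟨fun y => Finset.sum_nonneg fun x' _ =>
    mul_nonneg (hpi.1 x') ((isPMF_outputLaw hW l _).1 y), ?_⟩
  simp only [partialOutputLaw]
  rw [Finset.sum_comm]
  simp only [← Finset.mul_sum, (isPMF_outputLaw hW l _).2, mul_one, hpi.2]

lemma isPMF_blockPartialOutputLaw {n : ℕ} (hpX : ∀ k q, IsPMF (pX k q)) (hW : ∀ x, IsPMF (W x))
    (l : Fin L) (A : Finset (Fin K)) (q : Fin n → Q) (x : ∀ k, Fin n → X k) :
    IsPMF (blockPartialOutputLaw pX W l A q x) :=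
  isPMF_pi fun i => isPMF_partialOutputLaw hpX hW l A (q i) fun k => x k i

lemma partialOutputLaw_congr (l : Fin L) {A : Finset (Fin K)} (q : Q) {x x' : ∀ k, X k}
    (h : ∀ k ∈ A, x k = x' k) : partialOutputLaw pX W l A q x = partialOutputLaw pX W l A q x' := by
  funext y
  refine Finset.sum_congr rfl fun x'' _ => ?_
  rw [A.piecewise_congr h fun _ _ => rfl]

lemma blockPartialOutputLaw_congr {n : ℕ} (l : Fin L) {A : Finset (Fin K)} (q : Fin n → Q)
    {x x' : ∀ k, Fin n → X k} (h : ∀ k ∈ A, x k = x' k) (y : Fin n → Y l) :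
    blockPartialOutputLaw pX W l A q x y = blockPartialOutputLaw pX W l A q x' y := by
  refine Finset.prod_congr rfl fun i _ => ?_
  rw [partialOutputLaw_congr l (q i) fun k hk => congrFun (h k hk) i]

lemma blockPartialOutputLaw_eq_sum {n : ℕ} (l : Fin L) (A : Finset (Fin K)) (q : Fin n → Q)
    (x : ∀ k, Fin n → X k) (y : Fin n → Y l) :
    blockPartialOutputLaw pX W l A q x y =
      ∑ x' : ∀ k, Fin n → X k, (∏ k, ∏ i, pX k (q i) (x' k i)) *
        blockOutputLaw W l (A.piecewise x x') y := by
  simp only [blockPartialOutputLaw, partialOutputLaw]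
  rw [← sum_pi_prod fun i (x' : ∀ k, X k) => (∏ k, pX k (q i) (x' k)) *
    outputLaw W l (A.piecewise (fun k => x k i) x') (y i)]
  refine Finset.sum_nbij' (fun x' k i => x' i k) (fun x' i k => x' k i) (by simp) (by simp)
    (fun _ _ => rfl) (fun _ _ => rfl) fun x' _ => ?_
  rw [Finset.prod_mul_distrib, Finset.prod_comm, blockOutputLaw]
  congr 1
  refine Finset.prod_congr rfl fun i _ => ?_
  congr 2
  ext k
  by_cases h : k ∈ A <;> simp [h]

lemma sum_block_channel {n : ℕ} (l : Fin L) (x : ∀ k, Fin n → X k) (G : (Fin n → Y l) → ℝ) :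
    ∑ y : ∀ l, Fin n → Y l, (∏ i, W (fun k => x k i) (fun l => y l i)) * G (y l) =
      ∑ y, blockOutputLaw W l x y * G y := by
  have h := sum_pi_map (fun i (y : ∀ l, Y l) => W (fun k => x k i) y) (fun (_ : Fin n) y => y l) G
  simp only [blockOutputLaw, outputLaw]
  rw [← h]
  exact Finset.sum_nbij' (fun y i l => y l i) (fun y l i => y i l) (by simp) (by simp)
    (fun _ _ => rfl) (fun _ _ => rfl) fun _ _ => rfl

lemma sum_block_channel_ite {n : ℕ} (l : Fin L) (x : ∀ k, Fin n → X k) (y₁ : Fin n → Y l) :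
    (∑ y : ∀ l, Fin n → Y l, if y l = y₁ then ∏ i, W (fun k => x k i) (fun l => y l i) else 0) =
      blockOutputLaw W l x y₁ := by
  have h := sum_block_channel (W := W) l x fun y => if y = y₁ then 1 else 0
  simpa using h

lemma isPMF_block_channel {n : ℕ} (hW : ∀ x, IsPMF (W x)) (x : ∀ k, Fin n → X k) :
    IsPMF fun y : ∀ l, Fin n → Y l => ∏ i, W (fun k => x k i) (fun l => y l i) := by
  refine ⟨fun y => Finset.prod_nonneg fun i _ => (hW _).1 _, ?_⟩
  rw [← (isPMF_pi fun i : Fin n => hW fun k => x k i).2]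
  exact Finset.sum_nbij' (fun y i l => y l i) (fun y l i => y i l) (by simp) (by simp)
    (fun _ _ => rfl) (fun _ _ => rfl) fun _ _ => rfl

lemma isPMF_uniform {m : ℕ} (hm : m ≠ 0) : IsPMF fun _ : Fin m => (m : ℝ)⁻¹ :=
  ⟨fun _ => by positivity, by simp [hm]⟩

lemma isPMF_uniform_pi {M : Fin K → ℕ} (hM : ∀ k, M k ≠ 0) :
    IsPMF fun _ : ∀ k, Fin (M k) => ∏ k, (M k : ℝ)⁻¹ :=
  isPMF_pi fun k => isPMF_uniform (hM k)

lemma isPMF_NjointP (hpQ : IsPMF pQ) (hpX : ∀ k q, IsPMF (pX k q)) (hW : ∀ x, IsPMF (W x)) :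
    IsPMF (NjointP pQ pX W) := by
  refine ⟨fun z => mul_nonneg (mul_nonneg (hpQ.1 _) ((isPMF_pi fun k => hpX k z.1).1 _))
    ((hW _).1 _), ?_⟩
  simp only [NjointP, Fintype.sum_prod_type, ← Finset.mul_sum, (hW _).2, mul_one,
    (isPMF_pi fun k => hpX k _).2, hpQ.2]

/-- The law of the output given `Q` and the inputs in `A` is `partialOutputLaw`. -/
lemma distOf_NjointP_eq_mul (hpX : ∀ k q, IsPMF (pX k q)) (hW : ∀ x, IsPMF (W x))
    (l : Fin L) (A : Finset (Fin K)) (z : Q × (∀ k, X k) × (∀ l, Y l)) :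
    distOf (NjointP pQ pX W)
        (fun z => (z.2.2 l, (fun k : {k // k ∈ A} => z.2.1 k.1), z.1))
        (z.2.2 l, (fun k : {k // k ∈ A} => z.2.1 k.1), z.1) =
      distOf (NjointP pQ pX W) (fun z => ((fun k : {k // k ∈ A} => z.2.1 k.1), z.1))
        ((fun k : {k // k ∈ A} => z.2.1 k.1), z.1) *
        partialOutputLaw pX W l A z.1 z.2.1 (z.2.2 l) := by
  obtain ⟨q, x, y⟩ := z
  set E : (∀ k, X k) → Prop := fun x' =>
    (fun k : {k // k ∈ A} => x' k.1) = fun k : {k // k ∈ A} => x k.1 with hE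
  have hEiff : ∀ x', E x' ↔ ∀ k ∈ A, x' k = x k := by
    intro x'; simp [hE, funext_iff]
  have h := sum_pi_ite_resample (fun k => hpX k q) A E
    (fun x' x'' => by
      simp only [hEiff]
      exact forall₂_congr fun k hk => by simp [hk])
    (fun x' => outputLaw W l x' (y l)) x
    (fun x' x'' hx => by
      rw [A.piecewise_congr ((hEiff x').1 hx) fun _ _ => rfl])
  have h1 : distOf (NjointP pQ pX W) (fun z => ((fun k : {k // k ∈ A} => z.2.1 k.1), z.1))
        ((fun k : {k // k ∈ A} => x k.1), q) =
      pQ q * ∑ x', if E x' then ∏ k, pX k q (x' k) else 0 := by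
    simp only [distOf, Fintype.sum_prod_type, Prod.mk.injEq, NjointP]
    rw [Finset.sum_eq_single q]
    · rw [Finset.mul_sum]
      refine Finset.sum_congr rfl fun x' _ => ?_
      by_cases hx : E x'
      · simp only [hE] at hx
        simp [hE, hx, ← Finset.mul_sum, (hW x').2]
      · simp only [hE] at hx
        simp [hE, hx]
    · intro q' _ hq; simp [hq]
    · simp
  have h2 : distOf (NjointP pQ pX W)
        (fun z => (z.2.2 l, (fun k : {k // k ∈ A} => z.2.1 k.1), z.1))
        (y l, (fun k : {k // k ∈ A} => x k.1), q) =
      pQ q * ∑ x', if E x' then (∏ k, pX k q (x' k)) * outputLaw W l x' (y l) else 0 := by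
    simp only [distOf, Fintype.sum_prod_type, Prod.mk.injEq, NjointP]
    rw [Finset.sum_eq_single q]
    · rw [Finset.mul_sum]
      refine Finset.sum_congr rfl fun x' _ => ?_
      by_cases hx : E x'
      · simp only [hE] at hx
        simp [hE, hx, outputLaw, distOf, Finset.mul_sum, mul_assoc]
      · simp only [hE] at hx
        simp [hE, hx]
    · intro q' _ hq; simp [hq]
    · simp
  simp only [h1, h2, h, partialOutputLaw, mul_assoc]

lemma condEnt_NjointP (hpQ : IsPMF pQ) (hpX : ∀ k q, IsPMF (pX k q)) (hW : ∀ x, IsPMF (W x))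
    (l : Fin L) (A : Finset (Fin K)) :
    condEnt (NjointP pQ pX W) (fun z => z.2.2 l)
        (fun z => ((fun k : {k // k ∈ A} => z.2.1 k.1), z.1)) =
      ∑ z, NjointP pQ pX W z *
        -Real.logb 2 (partialOutputLaw pX W l A z.1 z.2.1 (z.2.2 l)) :=
  condEnt_eq_of_distOf_eq_mul (isPMF_NjointP hpQ hpX hW).1 _ _ _
    (distOf_NjointP_eq_mul hpX hW l A)

/-- `H(Y | X_{[K]}, Q) + I(X_{Aᶜ}; Y | X_A, Q) = H(Y | X_A, Q)`. -/
lemma condEnt_add_condMutInfo (l : Fin L) (A : Finset (Fin K)) :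
    condEnt (NjointP pQ pX W) (fun z => z.2.2 l) (fun z => (z.2.1, z.1)) +
      condMutInfo (NjointP pQ pX W)
        (fun z => fun k : {k // k ∈ Aᶜ} => z.2.1 k.1)
        (fun z => z.2.2 l)
        (fun z => ((fun k : {k // k ∈ A} => z.2.1 k.1), z.1)) =
    condEnt (NjointP pQ pX W) (fun z => z.2.2 l)
        (fun z => ((fun k : {k // k ∈ A} => z.2.1 k.1), z.1)) := by
  have hx : ∀ x x' : ∀ k, X k, x = x' ↔
      (∀ k ∉ A, x k = x' k) ∧ ∀ k ∈ A, x k = x' k := by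
    intro x x'
    refine ⟨fun h => by simp [h], fun h => funext fun k => ?_⟩
    by_cases hk : k ∈ A
    · exact h.2 k hk
    · exact h.1 k hk
  have e1 : entOf (NjointP pQ pX W) (fun z => (z.2.1, z.1)) =
      entOf (NjointP pQ pX W) (fun z => ((fun k : {k // k ∈ Aᶜ} => z.2.1 k.1),
        (fun k : {k // k ∈ A} => z.2.1 k.1), z.1)) := by
    refine entOf_congr _ fun z z' => ?_
    simp only [Prod.mk.injEq, hx, funext_iff, Subtype.forall, Finset.mem_compl]
    tauto
  have e2 : entOf (NjointP pQ pX W) (fun z => (z.2.2 l, z.2.1, z.1)) =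
      entOf (NjointP pQ pX W) (fun z => ((fun k : {k // k ∈ Aᶜ} => z.2.1 k.1), z.2.2 l,
        (fun k : {k // k ∈ A} => z.2.1 k.1), z.1)) := by
    refine entOf_congr _ fun z z' => ?_
    simp only [Prod.mk.injEq, hx, funext_iff, Subtype.forall, Finset.mem_compl]
    tauto
  simp only [condEnt, condMutInfo, e1, e2]
  ring

lemma isPMF_codeword {n : ℕ} (hpX : ∀ k q, IsPMF (pX k q)) (q : Fin n → Q) (k : Fin K) :
    IsPMF fun x : Fin n → X k => ∏ i, pX k (q i) (x i) :=
  isPMF_pi fun i => hpX k (q i)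

lemma sum_NensembleP {n : ℕ} {M : Fin K → ℕ} (F : NCodebook Q X n M → ℝ) :
    ∑ c : NCodebook Q X n M, NensembleP pQ pX c * F c =
      ∑ q : Fin n → Q, (∏ i, pQ (q i)) * ∑ c : ∀ k, Fin (M k) → Fin n → X k,
        (∏ k, ∏ m, ∏ i, pX k (q i) (c k m i)) * F (q, c) := by
  simp only [Fintype.sum_prod_type, NensembleP, Finset.mul_sum, mul_assoc]

lemma NensembleP_nonneg {n : ℕ} {M : Fin K → ℕ} (hpQ : IsPMF pQ) (hpX : ∀ k q, IsPMF (pX k q))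
    (c : NCodebook Q X n M) : 0 ≤ NensembleP pQ pX c :=
  mul_nonneg (Finset.prod_nonneg fun _ _ => hpQ.1 _) (Finset.prod_nonneg fun k _ =>
    Finset.prod_nonneg fun _ _ => (isPMF_codeword hpX c.1 k).1 _)

lemma sum_NexpP {n : ℕ} {M : Fin K → ℕ} (F : NExpSpace Q X Y n M → ℝ) :
    ∑ ω : NExpSpace Q X Y n M, NexpP pQ pX W ω * F ω =
      ∑ c : NCodebook Q X n M, NensembleP pQ pX c * ∑ m : ∀ k, Fin (M k),
        (∏ k, (M k : ℝ)⁻¹) * ∑ y : ∀ l, Fin n → Y l,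
          (∏ i, W (fun k => c.2 k (m k) i) (fun l => y l i)) * F (c, m, y) := by
  simp only [Fintype.sum_prod_type (α₁ := NCodebook Q X n M),
    Fintype.sum_prod_type (α₁ := ∀ k, Fin (M k)), NexpP, Finset.mul_sum, mul_assoc,
    Finset.prod_inv_distrib]

/-- The transmitted codewords and the channel outputs are jointly i.i.d. -/
lemma sum_NexpP_transmitted {n : ℕ} {M : Fin K → ℕ} (hM : ∀ k, M k ≠ 0)
    (hpX : ∀ k q, IsPMF (pX k q))
    (F : (Fin n → Q) → (∀ k, Fin n → X k) → (∀ l, Fin n → Y l) → ℝ) :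
    ∑ ω : NExpSpace Q X Y n M, NexpP pQ pX W ω *
        F ω.1.1 (fun k => ω.1.2 k (ω.2.1 k)) ω.2.2 =
      ∑ z : Fin n → Q × (∀ k, X k) × (∀ l, Y l), (∏ i, NjointP pQ pX W (z i)) *
        F (fun i => (z i).1) (fun k i => (z i).2.1 k) (fun l i => (z i).2.2 l) := by
  rw [sum_NexpP, sum_NensembleP]
  have h : ∀ q : Fin n → Q, ∑ c : ∀ k, Fin (M k) → Fin n → X k,
        (∏ k, ∏ m, ∏ i, pX k (q i) (c k m i)) * ∑ m : ∀ k, Fin (M k),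
        (∏ k, (M k : ℝ)⁻¹) * ∑ y : ∀ l, Fin n → Y l,
          (∏ i, W (fun k => c k (m k) i) (fun l => y l i)) * F q (fun k => c k (m k)) y =
      ∑ x : ∀ k, Fin n → X k, (∏ k, ∏ i, pX k (q i) (x k i)) * ∑ y : ∀ l, Fin n → Y l,
          (∏ i, W (fun k => x k i) (fun l => y l i)) * F q x y := by
    intro q
    have h1 := fun m : ∀ k, Fin (M k) => sum_codebook_single
      (fun k => isPMF_codeword hpX q k) m fun x => ∑ y : ∀ l, Fin n → Y l,
          (∏ i, W (fun k => x k i) (fun l => y l i)) * F q x y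
    rw [sum_mul_sum_mul_comm]
    simp only [h1]
    rw [← Finset.sum_mul, (isPMF_uniform_pi hM).2, one_mul]
  refine (Finset.sum_congr rfl fun q _ => congrArg _ (h q)).trans ?_
  simp only [Finset.mul_sum]
  simp only [← Fintype.sum_prod_type']
  refine Finset.sum_nbij' (fun w i => (w.1 i, (fun k => w.2.1 k i), fun l => w.2.2 l i))
    (fun z => (fun i => (z i).1, (fun k i => (z i).2.1 k), fun l i => (z i).2.2 l))
    (by simp) (by simp) (fun _ _ => rfl) (fun _ _ => rfl) fun w _ => ?_
  simp only [NjointP, Finset.prod_mul_distrib]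
  rw [Finset.prod_comm (s := (Finset.univ : Finset (Fin K)))]
  ring

lemma isPMF_NexpP {n : ℕ} {M : Fin K → ℕ} (hM : ∀ k, M k ≠ 0) (hpQ : IsPMF pQ)
    (hpX : ∀ k q, IsPMF (pX k q)) (hW : ∀ x, IsPMF (W x)) :
    IsPMF (NexpP pQ pX W (n := n) (M := M)) := by
  refine ⟨fun ω => mul_nonneg (mul_nonneg (NensembleP_nonneg hpQ hpX _) (by positivity))
    ((isPMF_block_channel hW _).1 _), ?_⟩
  have h := sum_NexpP_transmitted (pQ := pQ) (W := W) (n := n) hM hpX fun _ _ _ => 1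
  simp only [mul_one] at h
  rw [h]
  exact (isPMF_pi fun _ => isPMF_NjointP hpQ hpX hW).2

/-- The law of the output given the codebook and the transmitted codewords in `S` is
`mixtureLaw`. -/
lemma distOf_NexpP_eq_mul {n : ℕ} {M : Fin K → ℕ} (hM : ∀ k, M k ≠ 0)
    (hW : ∀ x, IsPMF (W x)) (l : Fin L) (S : Finset (Fin K)) (ω : NExpSpace Q X Y n M) :
    distOf (NexpP pQ pX W)
        (fun ω : NExpSpace Q X Y n M =>
          (ω.2.2 l, (fun k : {k // k ∈ S} => ω.1.2 k.1 (ω.2.1 k.1)), ω.1))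
        (ω.2.2 l, (fun k : {k // k ∈ S} => ω.1.2 k.1 (ω.2.1 k.1)), ω.1) =
      distOf (NexpP pQ pX W)
        (fun ω : NExpSpace Q X Y n M =>
          ((fun k : {k // k ∈ S} => ω.1.2 k.1 (ω.2.1 k.1)), ω.1))
        ((fun k : {k // k ∈ S} => ω.1.2 k.1 (ω.2.1 k.1)), ω.1) *
        mixtureLaw W l S ω.1.2 ω.2.1 (ω.2.2 l) := by
  obtain ⟨c, m, y⟩ := ω
  set E : (∀ k, Fin (M k)) → Prop := fun m' =>
    (fun k : {k // k ∈ S} => c.2 k.1 (m' k.1)) = fun k : {k // k ∈ S} => c.2 k.1 (m k.1) with hE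
  have hEiff : ∀ m', E m' ↔ ∀ k ∈ S, c.2 k (m' k) = c.2 k (m k) := by
    intro m'; simp [hE, funext_iff]
  have h := sum_pi_ite_resample (fun k => isPMF_uniform (hM k)) S E
    (fun m' m'' => by
      simp only [hEiff]
      exact forall₂_congr fun k hk => by simp [hk])
    (fun m' => blockOutputLaw W l (fun k => c.2 k (m' k)) (y l)) m
    (fun m' m'' hm => by
      congr 1
      ext k : 1
      by_cases hk : k ∈ S
      · simp [hk, (hEiff m').1 hm k hk]
      · simp [hk])
  have h1 : distOf (NexpP pQ pX W)
        (fun ω : NExpSpace Q X Y n M =>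
          ((fun k : {k // k ∈ S} => ω.1.2 k.1 (ω.2.1 k.1)), ω.1))
        ((fun k : {k // k ∈ S} => c.2 k.1 (m k.1)), c) =
      NensembleP pQ pX c * ∑ m' : ∀ k, Fin (M k), if E m' then ∏ k, (M k : ℝ)⁻¹ else 0 := by
    simp only [distOf, Prod.mk.injEq, NexpP]
    rw [Fintype.sum_prod_type, Finset.sum_eq_single c]
    · rw [Fintype.sum_prod_type, Finset.mul_sum]
      refine Finset.sum_congr rfl fun m' _ => ?_
      by_cases hx : E m'
      · simp only [hE] at hx
        simp [hE, hx, ← Finset.mul_sum, (isPMF_block_channel hW fun k => c.2 k (m' k)).2]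
      · simp only [hE] at hx
        simp [hE, hx]
    · intro c' _ hc; simp [hc]
    · simp
  have h2 : distOf (NexpP pQ pX W)
        (fun ω : NExpSpace Q X Y n M =>
          (ω.2.2 l, (fun k : {k // k ∈ S} => ω.1.2 k.1 (ω.2.1 k.1)), ω.1))
        (y l, (fun k : {k // k ∈ S} => c.2 k.1 (m k.1)), c) =
      NensembleP pQ pX c * ∑ m' : ∀ k, Fin (M k), if E m' then (∏ k, (M k : ℝ)⁻¹) *
        blockOutputLaw W l (fun k => c.2 k (m' k)) (y l) else 0 := by
    simp only [distOf, Prod.mk.injEq, NexpP]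
    rw [Fintype.sum_prod_type, Finset.sum_eq_single c]
    · rw [Fintype.sum_prod_type, Finset.mul_sum]
      refine Finset.sum_congr rfl fun m' _ => ?_
      by_cases hx : E m'
      · simp only [hE] at hx
        simp [hE, hx, ← sum_block_channel_ite, Finset.mul_sum, mul_assoc]
      · simp only [hE] at hx
        simp [hE, hx]
    · intro c' _ hc; simp [hc]
    · simp
  simp only [h1, h2, h, mixtureLaw, mul_assoc]

lemma sum_uniform_agree {M : Fin K → ℕ} (hM : ∀ k, M k ≠ 0) (U : Finset (Fin K))
    (m : ∀ k, Fin (M k)) :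
    ∑ m' : ∀ k, Fin (M k), (∏ k, (M k : ℝ)⁻¹) * (if ∀ k ∈ U, m' k = m k then 1 else 0) =
      ∏ k ∈ U, (M k : ℝ)⁻¹ := by
  have h : ∀ m' : ∀ k, Fin (M k),
      (∏ k, (M k : ℝ)⁻¹) * (if ∀ k ∈ U, m' k = m k then 1 else 0) =
        ∏ k, (M k : ℝ)⁻¹ * (if k ∈ U then if m' k = m k then 1 else 0 else 1) := by
    intro m'
    rw [Finset.prod_mul_distrib, Finset.prod_ite_mem, Finset.univ_inter, Finset.prod_ite_zero]
    simp
  simp only [h]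
  rw [sum_pi_prod fun k a => (M k : ℝ)⁻¹ * (if k ∈ U then if a = m k then 1 else 0 else 1),
    ← Finset.prod_ite_mem_eq U]
  refine Finset.prod_congr rfl fun k _ => ?_
  by_cases hk : k ∈ U
  · simp [hk]
  · simp [hk, hM k]

/-- The average of `mixtureLaw` over all codewords other than the transmitted ones is bounded
by a sum over the sets `U` of senders outside `S` whose messages are guessed correctly. -/
def mixtureBound (pX : ∀ k, Q → X k → ℝ) (W : (∀ k, X k) → (∀ l, Y l) → ℝ) {n : ℕ}
    (M : Fin K → ℕ) (l : Fin L) (S : Finset (Fin K)) (q : Fin n → Q)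
    (x : ∀ k, Fin n → X k) (y : Fin n → Y l) : ℝ :=
  ∑ U ∈ Sᶜ.powerset, (∏ k ∈ U, (M k : ℝ)⁻¹) * blockPartialOutputLaw pX W l (S ∪ U) q x y

lemma sum_blockPartialOutputLaw_agree_le {n : ℕ} {M : Fin K → ℕ} (hM : ∀ k, M k ≠ 0)
    (hpX : ∀ k q, IsPMF (pX k q)) (hW : ∀ x, IsPMF (W x)) (l : Fin L) (S : Finset (Fin K))
    (m : ∀ k, Fin (M k)) (q : Fin n → Q) (x : ∀ k, Fin n → X k) (y : Fin n → Y l) :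
    ∑ m' : ∀ k, Fin (M k), (∏ k, (M k : ℝ)⁻¹) * blockPartialOutputLaw pX W l
        (Finset.univ.filter fun k => S.piecewise m m' k = m k) q x y ≤
      mixtureBound pX W M l S q x y := by
  have hV := fun A : Finset (Fin K) => (isPMF_blockPartialOutputLaw hpX hW l A q x).1 y
  have hB : mixtureBound pX W M l S q x y = ∑ U ∈ Sᶜ.powerset, ∑ m' : ∀ k, Fin (M k),
      (∏ k, (M k : ℝ)⁻¹) * (if ∀ k ∈ U, m' k = m k then 1 else 0) *
        blockPartialOutputLaw pX W l (S ∪ U) q x y :=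
    Finset.sum_congr rfl fun U _ => by rw [← sum_uniform_agree hM U m, Finset.sum_mul]
  rw [hB, Finset.sum_comm]
  refine Finset.sum_le_sum fun m' _ => ?_
  set A := Finset.univ.filter fun k => S.piecewise m m' k = m k with hA
  have hSA : S ⊆ A := fun k hk => by simp [hA, hk]
  have hmem : A \ S ∈ Sᶜ.powerset := by
    rw [Finset.mem_powerset]
    intro k hk
    simpa using (Finset.mem_sdiff.1 hk).2
  refine le_trans ?_ (Finset.single_le_sum (fun U _ => mul_nonneg (mul_nonneg
    ((isPMF_uniform_pi hM).1 m') (by split_ifs <;> norm_num)) (hV (S ∪ U))) hmem)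
  have hag : ∀ k ∈ A \ S, m' k = m k := by
    intro k hk
    obtain ⟨h1, h2⟩ := Finset.mem_sdiff.1 hk
    simpa [hA, h2] using h1
  rw [if_pos hag, mul_one, Finset.union_sdiff_of_subset hSA]

lemma sum_NexpP_mixtureLaw_div_le {n : ℕ} {M : Fin K → ℕ} (hM : ∀ k, M k ≠ 0)
    (hpQ : IsPMF pQ) (hpX : ∀ k q, IsPMF (pX k q)) (hW : ∀ x, IsPMF (W x)) (l : Fin L)
    (S : Finset (Fin K)) :
    ∑ ω : NExpSpace Q X Y n M, NexpP pQ pX W ω *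
      (mixtureLaw W l S ω.1.2 ω.2.1 (ω.2.2 l) /
        mixtureBound pX W M l S ω.1.1 (fun k => ω.1.2 k (ω.2.1 k)) (ω.2.2 l)) ≤ 1 := by
  have hu := isPMF_uniform_pi hM
  have step : ∀ (q : Fin n → Q) (m : ∀ k, Fin (M k)),
      ∑ c : ∀ k, Fin (M k) → Fin n → X k, (∏ k, ∏ m, ∏ i, pX k (q i) (c k m i)) *
        ∑ y : ∀ l, Fin n → Y l, (∏ i, W (fun k => c k (m k) i) (fun l => y l i)) *
          (mixtureLaw W l S c m (y l) /
            mixtureBound pX W M l S q (fun k => c k (m k)) (y l)) ≤ 1 := by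
    intro q m
    have hμ := fun k => isPMF_codeword (n := n) hpX q k
    set F : (∀ k, Fin n → X k) → (∀ k, Fin n → X k) → ℝ := fun x x' =>
      ∑ y : ∀ l, Fin n → Y l, (∏ i, W (fun k => x k i) (fun l => y l i)) *
        (blockOutputLaw W l x' (y l) / mixtureBound pX W M l S q x (y l)) with hF
    have h1 : ∀ c : ∀ k, Fin (M k) → Fin n → X k,
        ∑ y : ∀ l, Fin n → Y l, (∏ i, W (fun k => c k (m k) i) (fun l => y l i)) *
          (mixtureLaw W l S c m (y l) /
            mixtureBound pX W M l S q (fun k => c k (m k)) (y l)) =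
        ∑ m' : ∀ k, Fin (M k), (∏ k, (M k : ℝ)⁻¹) *
          F (fun k => c k (m k)) (fun k => c k (S.piecewise m m' k)) := by
      intro c
      simp only [mixtureLaw, Finset.sum_div, mul_div_assoc]
      exact sum_mul_sum_mul_comm _ _ _
    have h2 : ∀ (x : ∀ k, Fin n → X k) (A : Finset (Fin K)),
        ∑ x' : ∀ k, Fin n → X k, (∏ k, ∏ i, pX k (q i) (x' k i)) * F x (A.piecewise x x') =
        ∑ y : ∀ l, Fin n → Y l, (∏ i, W (fun k => x k i) (fun l => y l i)) *
          (blockPartialOutputLaw pX W l A q x (y l) / mixtureBound pX W M l S q x (y l)) := by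
      intro x A
      simp only [hF]
      rw [sum_mul_sum_mul_comm]
      simp only [← mul_div_assoc, ← Finset.sum_div, blockPartialOutputLaw_eq_sum]
    have h3 : ∀ m' : ∀ k, Fin (M k),
        ∑ c : ∀ k, Fin (M k) → Fin n → X k, (∏ k, ∏ m, ∏ i, pX k (q i) (c k m i)) *
          F (fun k => c k (m k)) (fun k => c k (S.piecewise m m' k)) =
        ∑ x : ∀ k, Fin n → X k, (∏ k, ∏ i, pX k (q i) (x k i)) *
          ∑ y : ∀ l, Fin n → Y l, (∏ i, W (fun k => x k i) (fun l => y l i)) *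
          (blockPartialOutputLaw pX W l
            (Finset.univ.filter fun k => S.piecewise m m' k = m k) q x (y l) /
              mixtureBound pX W M l S q x (y l)) := by
      intro m'
      rw [sum_codebook_pair hμ m (S.piecewise m m') F]
      simp only [mul_assoc, ← Finset.mul_sum, h2]
    simp only [h1]
    rw [sum_mul_sum_mul_comm]
    simp only [h3]
    rw [sum_mul_sum_mul_comm, ← (isPMF_pi hμ).2]
    refine Finset.sum_le_sum fun x _ => mul_le_of_le_one_right ((isPMF_pi hμ).1 x) ?_
    rw [sum_mul_sum_mul_comm, ← (isPMF_block_channel hW x).2]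
    refine Finset.sum_le_sum fun y _ =>
      mul_le_of_le_one_right ((isPMF_block_channel hW x).1 y) ?_
    simp only [← mul_div_assoc, ← Finset.sum_div]
    have hle := sum_blockPartialOutputLaw_agree_le hM hpX hW l S m q x (y l)
    refine div_le_one_of_le₀ hle (le_trans (Finset.sum_nonneg fun m' _ => ?_) hle)
    exact mul_nonneg (hu.1 m') ((isPMF_blockPartialOutputLaw hpX hW l _ q x).1 _)
  rw [sum_NexpP, sum_NensembleP]
  have hq := isPMF_pi fun _ : Fin n => hpQ
  rw [← hq.2]
  refine Finset.sum_le_sum fun q _ => mul_le_of_le_one_right (hq.1 q) ?_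
  rw [sum_mul_sum_mul_comm, ← hu.2]
  exact Finset.sum_le_sum fun m _ => mul_le_of_le_one_right (hu.1 m) (step q m)

/-- The law of the output obtained by resampling the messages in `U` and all codewords outside
`S ∪ U`. -/
def guessLaw (pX : ∀ k, Q → X k → ℝ) (W : (∀ k, X k) → (∀ l, Y l) → ℝ) {n : ℕ}
    {M : Fin K → ℕ} (l : Fin L) (S U : Finset (Fin K)) (c : NCodebook Q X n M)
    (m : ∀ k, Fin (M k)) (y : Fin n → Y l) : ℝ :=
  ∑ m' : ∀ k, Fin (M k), (∏ k, (M k : ℝ)⁻¹) *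
    blockPartialOutputLaw pX W l (S ∪ U) c.1 (fun k => c.2 k (S.piecewise m m' k)) y

lemma isPMF_guessLaw {n : ℕ} {M : Fin K → ℕ} (hM : ∀ k, M k ≠ 0)
    (hpX : ∀ k q, IsPMF (pX k q)) (hW : ∀ x, IsPMF (W x)) (l : Fin L) (S U : Finset (Fin K))
    (c : NCodebook Q X n M) (m : ∀ k, Fin (M k)) : IsPMF (guessLaw pX W l S U c m) := by
  have hV := fun x => isPMF_blockPartialOutputLaw hpX hW l (S ∪ U) c.1 x
  refine ⟨fun y => Finset.sum_nonneg fun m' _ =>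
    mul_nonneg ((isPMF_uniform_pi hM).1 m') ((hV _).1 y), ?_⟩
  simp only [guessLaw]
  rw [Finset.sum_comm]
  simp only [← Finset.mul_sum, (hV _).2, mul_one, (isPMF_uniform_pi hM).2]

lemma le_guessLaw {n : ℕ} {M : Fin K → ℕ} (hM : ∀ k, M k ≠ 0)
    (hpX : ∀ k q, IsPMF (pX k q)) (hW : ∀ x, IsPMF (W x)) (l : Fin L) (S U : Finset (Fin K))
    (c : NCodebook Q X n M) (m : ∀ k, Fin (M k)) (y : Fin n → Y l) :
    (∏ k ∈ U, (M k : ℝ)⁻¹) *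
        blockPartialOutputLaw pX W l (S ∪ U) c.1 (fun k => c.2 k (m k)) y ≤
      guessLaw pX W l S U c m y := by
  rw [← sum_uniform_agree hM U m, Finset.sum_mul]
  refine Finset.sum_le_sum fun m' _ => ?_
  rw [mul_assoc]
  refine mul_le_mul_of_nonneg_left ?_ ((isPMF_uniform_pi hM).1 m')
  split_ifs with h
  · rw [one_mul, blockPartialOutputLaw_congr]
    intro k hk
    by_cases hS : k ∈ S
    · simp [hS]
    · simp [hS, h k ((Finset.mem_union.1 hk).resolve_left hS)]
  · rw [zero_mul]
    exact (isPMF_blockPartialOutputLaw hpX hW l _ _ _).1 y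

lemma sum_NexpP_guessLaw_div_le {n : ℕ} {M : Fin K → ℕ} (hM : ∀ k, M k ≠ 0)
    (hpQ : IsPMF pQ) (hpX : ∀ k q, IsPMF (pX k q)) (hW : ∀ x, IsPMF (W x)) (l : Fin L)
    (S U : Finset (Fin K)) :
    ∑ ω : NExpSpace Q X Y n M, NexpP pQ pX W ω *
      (guessLaw pX W l S U ω.1 ω.2.1 (ω.2.2 l) /
        mixtureLaw W l S ω.1.2 ω.2.1 (ω.2.2 l)) ≤ 1 := by
  have hu := isPMF_uniform_pi hM
  have hP := isPMF_NexpP (n := n) hM hpQ hpX hW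
  have h1 := sum_NexpP (pQ := pQ) (pX := pX) (W := W) (n := n) (M := M) fun _ => 1
  simp only [mul_one] at h1
  rw [sum_NexpP, ← hP.2, h1]
  refine Finset.sum_le_sum fun c _ =>
    mul_le_mul_of_nonneg_left ?_ (NensembleP_nonneg hpQ hpX c)
  simp only [(isPMF_block_channel hW _).2, mul_one, hu.2]
  have h2 := fun m : ∀ k, Fin (M k) => sum_block_channel (W := W) l (fun k => c.2 k (m k))
    fun y => guessLaw pX W l S U c m y / mixtureLaw W l S c.2 m y
  simp only [h2]
  rw [sum_pi_resample (fun k => isPMF_uniform (hM k)) S]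
  rw [← hu.2]
  refine Finset.sum_le_sum fun m _ => mul_le_of_le_one_right (hu.1 m) ?_
  have h3 : ∀ m', guessLaw pX W l S U c (S.piecewise m m') = guessLaw pX W l S U c m := by
    intro m'; funext y; simp only [guessLaw, Finset.piecewise_idem_left]
  have h4 : ∀ m', mixtureLaw W l S c.2 (S.piecewise m m') = mixtureLaw W l S c.2 m := by
    intro m'; funext y; simp only [mixtureLaw, Finset.piecewise_idem_left]
  simp only [h3, h4, Finset.mul_sum, ← mul_assoc]
  rw [Finset.sum_comm, ← (isPMF_guessLaw hM hpX hW l S U c m).2]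
  refine Finset.sum_le_sum fun y _ => ?_
  rw [← Finset.sum_mul]
  change mixtureLaw W l S c.2 m y * _ ≤ _
  by_cases h0 : mixtureLaw W l S c.2 m y = 0
  · rw [h0, zero_mul]
    exact (isPMF_guessLaw hM hpX hW l S U c m).1 y
  · rw [mul_div_cancel₀ _ h0]

lemma partialOutputLaw_pos (hpX : ∀ k q, IsPMF (pX k q)) (hW : ∀ x, IsPMF (W x)) (l : Fin L)
    (A : Finset (Fin K)) {q : Q} {x : ∀ k, X k} {y : ∀ l, Y l} (hx : ∀ k, 0 < pX k q (x k))
    (hy : 0 < W x y) : 0 < partialOutputLaw pX W l A q x (y l) := by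
  have h1 : 0 < ∏ k, pX k q (x k) := Finset.prod_pos fun k _ => hx k
  have h2 : 0 < outputLaw W l x (y l) := hy.trans_le (le_distOf (hW x).1 (fun y => y l) y)
  refine (mul_pos h1 h2).trans_le (le_trans (le_of_eq ?_) (Finset.single_le_sum
    (f := fun x' : ∀ k, X k => (∏ k, pX k q (x' k)) * outputLaw W l (A.piecewise x x') (y l))
    (fun x' _ => mul_nonneg ((isPMF_pi fun k => hpX k q).1 x') ((isPMF_outputLaw hW l _).1 _))
    (Finset.mem_univ x)))
  have h3 : A.piecewise x x = x := funext fun k => by by_cases hk : k ∈ A <;> simp [hk]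
  simp only [h3]

lemma partialOutputLaw_pos_of_NexpP_pos {n : ℕ} {M : Fin K → ℕ}
    (hpX : ∀ k q, IsPMF (pX k q)) (hW : ∀ x, IsPMF (W x)) (l : Fin L) (A : Finset (Fin K))
    {ω : NExpSpace Q X Y n M} (h : 0 < NexpP pQ pX W ω) (i : Fin n) :
    0 < partialOutputLaw pX W l A (ω.1.1 i) (fun k => ω.1.2 k (ω.2.1 k) i) (ω.2.2 l i) := by
  have h0 := h.ne'
  simp only [NexpP, NensembleP, mul_ne_zero_iff, Finset.prod_ne_zero_iff, Finset.mem_univ,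
    forall_true_left] at h0
  exact partialOutputLaw_pos hpX hW l A (y := fun l => ω.2.2 l i)
    (fun k => lt_of_le_of_ne ((hpX k _).1 _) (h0.1.1.2 k _ i).symm)
    (lt_of_le_of_ne ((hW _).1 _) (h0.2 i).symm)

/-- The conditional information density `-log p(y | x_A, q)`. -/
def infoDensity (pX : ∀ k, Q → X k → ℝ) (W : (∀ k, X k) → (∀ l, Y l) → ℝ) (l : Fin L)
    (A : Finset (Fin K)) (z : Q × (∀ k, X k) × (∀ l, Y l)) : ℝ :=
  -Real.logb 2 (partialOutputLaw pX W l A z.1 z.2.1 (z.2.2 l))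

/-- The transmitted single-letter triple at time `i`. -/
def transmitted {n : ℕ} {M : Fin K → ℕ} (ω : NExpSpace Q X Y n M) (i : Fin n) :
    Q × (∀ k, X k) × (∀ l, Y l) :=
  (ω.1.1 i, (fun k => ω.1.2 k (ω.2.1 k) i), fun l => ω.2.2 l i)

lemma sum_NexpP_comp_transmitted {n : ℕ} {M : Fin K → ℕ} (hM : ∀ k, M k ≠ 0)
    (hpX : ∀ k q, IsPMF (pX k q)) (F : (Fin n → Q × (∀ k, X k) × (∀ l, Y l)) → ℝ) :
    ∑ ω : NExpSpace Q X Y n M, NexpP pQ pX W ω * F (transmitted ω) =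
      ∑ z : Fin n → Q × (∀ k, X k) × (∀ l, Y l), (∏ i, NjointP pQ pX W (z i)) * F z :=
  sum_NexpP_transmitted hM hpX fun q x y => F fun i => (q i, (fun k => x k i), fun l => y l i)

lemma logb_mul_blockPartialOutputLaw {n : ℕ} {M : Fin K → ℕ} (hM : ∀ k, M k ≠ 0)
    (hpX : ∀ k q, IsPMF (pX k q)) (hW : ∀ x, IsPMF (W x)) (l : Fin L) (A U : Finset (Fin K))
    {ω : NExpSpace Q X Y n M} (h : 0 < NexpP pQ pX W ω) :
    0 < (∏ k ∈ U, (M k : ℝ)⁻¹) *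
        blockPartialOutputLaw pX W l A ω.1.1 (fun k => ω.1.2 k (ω.2.1 k)) (ω.2.2 l) ∧
    Real.logb 2 ((∏ k ∈ U, (M k : ℝ)⁻¹) *
        blockPartialOutputLaw pX W l A ω.1.1 (fun k => ω.1.2 k (ω.2.1 k)) (ω.2.2 l)) =
      -(∑ k ∈ U, Real.logb 2 (M k) + ∑ i, infoDensity pX W l A (transmitted ω i)) := by
  have hpos := partialOutputLaw_pos_of_NexpP_pos hpX hW l A h
  have hM' : ∀ k, (0 : ℝ) < (M k : ℝ)⁻¹ := fun k => by
    have := Nat.pos_of_ne_zero (hM k); positivity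
  have h1 : 0 < ∏ k ∈ U, (M k : ℝ)⁻¹ := Finset.prod_pos fun k _ => hM' k
  have h2 : 0 < blockPartialOutputLaw pX W l A ω.1.1 (fun k => ω.1.2 k (ω.2.1 k)) (ω.2.2 l) :=
    Finset.prod_pos fun i _ => hpos i
  refine ⟨mul_pos h1 h2, ?_⟩
  rw [Real.logb_mul h1.ne' h2.ne', Real.logb_prod _ _ fun k _ => (hM' k).ne',
    blockPartialOutputLaw, Real.logb_prod _ _ fun i _ => (hpos i).ne']
  simp [infoDensity, transmitted, Real.logb_inv, Finset.sum_neg_distrib]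
  ring

/-- The upper bound `H(Y^n | X_S^n, C_n) ≤ log |M_U| + n H(Y | X_{S ∪ U}, Q)`. -/
lemma condEnt_NexpP_le {n : ℕ} {M : Fin K → ℕ} (hM : ∀ k, M k ≠ 0)
    (hpQ : IsPMF pQ) (hpX : ∀ k q, IsPMF (pX k q)) (hW : ∀ x, IsPMF (W x)) (l : Fin L)
    (S U : Finset (Fin K)) :
    condEnt (NexpP pQ pX W (n := n) (M := M)) (fun ω => ω.2.2 l)
        (fun ω => ((fun k : {k // k ∈ S} => ω.1.2 k.1 (ω.2.1 k.1)), ω.1)) ≤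
      ∑ k ∈ U, Real.logb 2 (M k) +
        n * ∑ z, NjointP pQ pX W z * infoDensity pX W l (S ∪ U) z := by
  have hP := isPMF_NexpP (n := n) hM hpQ hpX hW
  have hpos : ∀ ω : NExpSpace Q X Y n M, 0 < NexpP pQ pX W ω →
      0 < guessLaw pX W l S U ω.1 ω.2.1 (ω.2.2 l) := fun ω h =>
    (logb_mul_blockPartialOutputLaw hM hpX hW l (S ∪ U) U h).1.trans_le
      (le_guessLaw hM hpX hW l S U ω.1 ω.2.1 (ω.2.2 l))
  rw [condEnt_eq_of_distOf_eq_mul hP.1 _ _ _ (distOf_NexpP_eq_mul hM hW l S)]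
  refine (sum_mul_neg_logb_le hP _ _ hpos (fun ω h => pos_of_distOf_eq_mul hP.1 _ _ _
    (distOf_NexpP_eq_mul hM hW l S) h) (sum_NexpP_guessLaw_div_le hM hpQ hpX hW l S U)).trans ?_
  have h1 : ∀ ω : NExpSpace Q X Y n M,
      NexpP pQ pX W ω * -Real.logb 2 (guessLaw pX W l S U ω.1 ω.2.1 (ω.2.2 l)) ≤
      NexpP pQ pX W ω * (∑ k ∈ U, Real.logb 2 (M k) +
        ∑ i, infoDensity pX W l (S ∪ U) (transmitted ω i)) := by
    intro ω
    rcases (hP.1 ω).eq_or_lt with h0 | h0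
    · simp [← h0]
    obtain ⟨h2, h3⟩ := logb_mul_blockPartialOutputLaw hM hpX hW l (S ∪ U) U h0
    have h4 := Real.logb_le_logb_of_le (b := 2) (by norm_num) h2
      (le_guessLaw hM hpX hW l S U ω.1 ω.2.1 (ω.2.2 l))
    refine mul_le_mul_of_nonneg_left ?_ h0.le
    linarith
  refine (Finset.sum_le_sum fun ω _ => h1 ω).trans (le_of_eq ?_)
  rw [sum_NexpP_comp_transmitted hM hpX fun z => ∑ k ∈ U, Real.logb 2 (M k) +
        ∑ i, infoDensity pX W l (S ∪ U) (z i)]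
  simp only [mul_add, Finset.sum_add_distrib]
  rw [sum_iid_sum (isPMF_NjointP hpQ hpX hW), ← Finset.sum_mul,
    (isPMF_pi fun _ : Fin n => isPMF_NjointP hpQ hpX hW).2, one_mul]

/-- The lower bound on `H(Y^n | X_S^n, C_n)`, tight up to a term of order `√n`. -/
lemma le_condEnt_NexpP {n : ℕ} {M : Fin K → ℕ} (hM : ∀ k, M k ≠ 0)
    (hpQ : IsPMF pQ) (hpX : ∀ k q, IsPMF (pX k q)) (hW : ∀ x, IsPMF (W x)) (l : Fin L)
    (S : Finset (Fin K)) (a : ℝ)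
    (ha : ∀ U ∈ Sᶜ.powerset, a ≤ ∑ k ∈ U, Real.logb 2 (M k) +
        n * ∑ z, NjointP pQ pX W z * infoDensity pX W l (S ∪ U) z) :
    a - (Sᶜ.card : ℝ) - √n * ∑ U ∈ Sᶜ.powerset, ((∑ z, NjointP pQ pX W z *
        (infoDensity pX W l (S ∪ U) z -
          ∑ z, NjointP pQ pX W z * infoDensity pX W l (S ∪ U) z) ^ 2 + 1) / 2) ≤
    condEnt (NexpP pQ pX W (n := n) (M := M)) (fun ω => ω.2.2 l)
        (fun ω => ((fun k : {k // k ∈ S} => ω.1.2 k.1 (ω.2.1 k.1)), ω.1)) := by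
  have hP := isPMF_NexpP (n := n) hM hpQ hpX hW
  have hJ := isPMF_NjointP hpQ hpX hW
  have hJn := isPMF_pi fun _ : Fin n => hJ
  set D : Finset (Fin K) → (Fin n → Q × (∀ k, X k) × (∀ l, Y l)) → ℝ := fun U z =>
    |∑ i, infoDensity pX W l (S ∪ U) (z i) -
      n * ∑ z, NjointP pQ pX W z * infoDensity pX W l (S ∪ U) z| with hD
  have hpos : ∀ ω : NExpSpace Q X Y n M, 0 < NexpP pQ pX W ω →
      0 < mixtureBound pX W M l S ω.1.1 (fun k => ω.1.2 k (ω.2.1 k)) (ω.2.2 l) := fun ω h =>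
    Finset.sum_pos (fun U _ => (logb_mul_blockPartialOutputLaw hM hpX hW l (S ∪ U) U h).1)
      ⟨∅, Finset.empty_mem_powerset _⟩
  rw [condEnt_eq_of_distOf_eq_mul hP.1 _ _ _ (distOf_NexpP_eq_mul hM hW l S)]
  refine le_trans ?_ (sum_mul_neg_logb_le hP _ _ (fun ω h => pos_of_distOf_eq_mul hP.1 _ _ _
    (distOf_NexpP_eq_mul hM hW l S) h) hpos (sum_NexpP_mixtureLaw_div_le hM hpQ hpX hW l S))
  have h1 : ∀ ω : NExpSpace Q X Y n M,
      NexpP pQ pX W ω * (a - (Sᶜ.card : ℝ) - ∑ U ∈ Sᶜ.powerset, D U (transmitted ω)) ≤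
      NexpP pQ pX W ω * -Real.logb 2
        (mixtureBound pX W M l S ω.1.1 (fun k => ω.1.2 k (ω.2.1 k)) (ω.2.2 l)) := by
    intro ω
    rcases (hP.1 ω).eq_or_lt with h0 | h0
    · simp [← h0]
    refine mul_le_mul_of_nonneg_left ?_ h0.le
    set Δ := ∑ U ∈ Sᶜ.powerset, D U (transmitted ω) with hΔ
    have h2 : mixtureBound pX W M l S ω.1.1 (fun k => ω.1.2 k (ω.2.1 k)) (ω.2.2 l) ≤
        2 ^ ((Sᶜ.card : ℝ) + (Δ - a)) := by
      have h3 : ∀ U ∈ Sᶜ.powerset, (∏ k ∈ U, (M k : ℝ)⁻¹) * blockPartialOutputLaw pX W l (S ∪ U)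
          ω.1.1 (fun k => ω.1.2 k (ω.2.1 k)) (ω.2.2 l) ≤ 2 ^ (Δ - a) := by
        intro U hU
        obtain ⟨h4, h5⟩ := logb_mul_blockPartialOutputLaw hM hpX hW l (S ∪ U) U h0
        rw [← Real.logb_le_iff_le_rpow (by norm_num) h4, h5]
        have h6 : D U (transmitted ω) ≤ Δ :=
          Finset.single_le_sum (f := fun U => D U (transmitted ω)) (fun _ _ => abs_nonneg _) hU
        have h7 := neg_abs_le (∑ i, infoDensity pX W l (S ∪ U) (transmitted ω i) -
          n * ∑ z, NjointP pQ pX W z * infoDensity pX W l (S ∪ U) z)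
        have h8 := ha U hU
        simp only [hD] at h6
        linarith
      refine (Finset.sum_le_sum h3).trans (le_of_eq ?_)
      rw [Finset.sum_const, Finset.card_powerset, nsmul_eq_mul, Real.rpow_add (by norm_num),
        Real.rpow_natCast]
      push_cast
      rfl
    rw [← Real.logb_le_iff_le_rpow (by norm_num) (hpos ω h0)] at h2
    linarith
  refine le_trans ?_ (Finset.sum_le_sum fun ω _ => h1 ω)
  rw [sum_NexpP_comp_transmitted hM hpX fun z =>
    a - (Sᶜ.card : ℝ) - ∑ U ∈ Sᶜ.powerset, D U z]
  simp only [mul_sub _ (a - _), Finset.sum_sub_distrib, ← Finset.sum_mul, hJn.2, one_mul]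
  refine sub_le_sub_left ?_ _
  simp only [Finset.mul_sum]
  rw [Finset.sum_comm]
  refine Finset.sum_le_sum fun U _ => ?_
  exact sum_iid_abs_le hJ (infoDensity pX W l (S ∪ U)) n

end RandomCodebook

/-- **Lemma 2.** If `D1 ⊆ S ⊆ [K]`, then for the random code ensemble used over the
`(K, L)`-DM-IN, `(1/n) H(Y1^n | X_S^n, C_n)` converges to
`H(Y1 | X_{[K]}, Q) + min_{U ⊆ Sᶜ} (R_U + I(X_{(S ∪ U)ᶜ}; Y1 | X_{S ∪ U}, Q))`. -/
theorem conditional_output_entropy_limit_network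
    (l1 : Fin L) (D1 S : Finset (Fin K)) (hD1S : D1 ⊆ S)
    (R : Fin K → ℝ) (hR : ∀ k, 0 ≤ R k)
    (hpQ : IsPMF pQ) (hpX : ∀ k q, IsPMF (pX k q)) (hW : ∀ x, IsPMF (W x)) :
    Tendsto (fun n : ℕ => ((n : ℝ))⁻¹ *
        condEnt (NexpP pQ pX W (n := n) (M := fun k => msgSize n (R k)))
          (fun ω => ω.2.2 l1)
          (fun ω => ((fun k : {k // k ∈ S} => ω.1.2 k.1 (ω.2.1 k.1)), ω.1)))
      atTop
      (nhds (condEnt (NjointP pQ pX W) (fun z => z.2.2 l1) (fun z => (z.2.1, z.1)) +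
        (Sᶜ.powerset.inf' ⟨∅, Finset.empty_mem_powerset _⟩ fun U =>
          (∑ k ∈ U, R k) +
            condMutInfo (NjointP pQ pX W)
              (fun z => fun k : {k // k ∈ (S ∪ U)ᶜ} => z.2.1 k.1)
              (fun z => z.2.2 l1)
              (fun z => ((fun k : {k // k ∈ S ∪ U} => z.2.1 k.1), z.1))))) := by
  set h : Finset (Fin K) → ℝ := fun U =>
    ∑ z, NjointP pQ pX W z * infoDensity pX W l1 (S ∪ U) z with hh
  set C : ℝ := ∑ U ∈ Sᶜ.powerset, ((∑ z, NjointP pQ pX W z *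
    (infoDensity pX W l1 (S ∪ U) z - h U) ^ 2 + 1) / 2) with hC
  have hne : Sᶜ.powerset.Nonempty := ⟨∅, Finset.empty_mem_powerset _⟩
  have hent : ∀ U, condEnt (NjointP pQ pX W) (fun z => z.2.2 l1) (fun z => (z.2.1, z.1)) +
      ((∑ k ∈ U, R k) + condMutInfo (NjointP pQ pX W)
        (fun z => fun k : {k // k ∈ (S ∪ U)ᶜ} => z.2.1 k.1) (fun z => z.2.2 l1)
        (fun z => ((fun k : {k // k ∈ S ∪ U} => z.2.1 k.1), z.1))) = (∑ k ∈ U, R k) + h U := by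
    intro U
    rw [add_left_comm, condEnt_add_condMutInfo, condEnt_NjointP hpQ hpX hW]
    rfl
  have hlim : condEnt (NjointP pQ pX W) (fun z => z.2.2 l1) (fun z => (z.2.1, z.1)) +
      (Sᶜ.powerset.inf' hne fun U => (∑ k ∈ U, R k) + condMutInfo (NjointP pQ pX W)
        (fun z => fun k : {k // k ∈ (S ∪ U)ᶜ} => z.2.1 k.1) (fun z => z.2.2 l1)
        (fun z => ((fun k : {k // k ∈ S ∪ U} => z.2.1 k.1), z.1))) =
      Sᶜ.powerset.inf' hne fun U => (∑ k ∈ U, R k) + h U := by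
    simp only [← hent]
    exact Finset.apply_inf'_eq_inf'_comp hne
      (condEnt (NjointP pQ pX W) (fun z => z.2.2 l1) (fun z => (z.2.1, z.1)) + ·)
      fun x y => (min_add_add_left _ x y).symm
  rw [hlim]
  set b : ℕ → ℝ := fun n => Sᶜ.powerset.inf' hne fun U =>
    (∑ k ∈ U, (n : ℝ)⁻¹ * Real.logb 2 (msgSize n (R k))) + h U with hb
  have hbt : Tendsto b atTop (nhds (Sᶜ.powerset.inf' hne fun U => (∑ k ∈ U, R k) + h U)) :=
    Tendsto.finset_inf'_nhds_apply hne fun U _ =>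
      (tendsto_finsetSum _ fun k _ => tendsto_logb_msgSize (hR k)).add_const _
  have hcard : Tendsto (fun n : ℕ => (Sᶜ.card : ℝ) * (n : ℝ)⁻¹) atTop (nhds 0) := by
    simpa using (tendsto_inv_atTop_nhds_zero_nat (𝕜 := ℝ)).const_mul (Sᶜ.card : ℝ)
  have hsqrt : Tendsto (fun n : ℕ => C * (√(n : ℝ))⁻¹) atTop (nhds 0) := by
    simpa using (tendsto_inv_atTop_zero.comp
      (Real.tendsto_sqrt_atTop.comp tendsto_natCast_atTop_atTop)).const_mul C
  have hscale : ∀ n : ℕ, 0 < n → ∀ U : Finset (Fin K),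
      ∑ k ∈ U, Real.logb 2 (msgSize n (R k)) + n * h U =
        n * ((∑ k ∈ U, (n : ℝ)⁻¹ * Real.logb 2 (msgSize n (R k))) + h U) := by
    intro n hn U
    have hn' : (n : ℝ) ≠ 0 := by exact_mod_cast hn.ne'
    rw [← Finset.mul_sum, mul_add, mul_inv_cancel_left₀ hn']
  refine tendsto_of_tendsto_of_tendsto_of_le_of_le'
    (by simpa using (hbt.sub hcard).sub hsqrt) hbt ?_ ?_
  · filter_upwards [eventually_gt_atTop 0] with n hn
    have hn' : (0 : ℝ) < n := by exact_mod_cast hn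
    have key := le_condEnt_NexpP (n := n) (M := fun k => msgSize n (R k))
      (fun k => NeZero.ne _) hpQ hpX hW l1 S (n * b n) fun U hU => by
        have := hscale n hn U
        simp only [hh] at this
        rw [this]
        exact mul_le_mul_of_nonneg_left (Finset.inf'_le _ hU) hn'.le
    refine le_trans (le_of_eq ?_) (mul_le_mul_of_nonneg_left key (inv_nonneg.2 hn'.le))
    have hs : (n : ℝ)⁻¹ * √(n : ℝ) = (√(n : ℝ))⁻¹ := by
      rw [← Real.sqrt_div_self, div_eq_inv_mul]
    change _ = (n : ℝ)⁻¹ * (n * b n - (Sᶜ.card : ℝ) - √(n : ℝ) * C)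
    rw [← hs, mul_sub, mul_sub, inv_mul_cancel_left₀ hn'.ne']
    ring
  · filter_upwards [eventually_gt_atTop 0] with n hn
    have hn' : (0 : ℝ) < n := by exact_mod_cast hn
    refine Finset.le_inf' _ _ fun U _ => ?_
    have key := condEnt_NexpP_le (n := n) (M := fun k => msgSize n (R k))
      (fun k => NeZero.ne _) hpQ hpX hW l1 S U
    rw [inv_mul_le_iff₀ hn', ← hscale n hn U]
    exact key

end Network
end
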